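/- arXiv:1710.02230 — 4 statements merged into one kernel-verified Lean document; each statement's English description precedes it below -/
import Mathlib

section
/- Let A be an abelian category with exact set-indexed coproducts and let T ∈ A satisfy Ext^i_A(T, T^{(I)}) = 0 for all i > 0 and all sets I, where T^{(I)} is the coproduct of I copies of T. Then the composition Hot^b(Add(T)) → Hot^b(A) → D^b(A) is fully faithful, i.e., for any two bounded complexes X•, Y• with terms in Add(T), the natural map Hom_{Hot^b(A)}(X•, Y•) → Hom_{D^b(A)}(X•, Y•) is an isomorphism. -/
open CategoryTheory Limits

universe w v u

/-- `InAdd T X` means `X` is a direct summand of a coproduct of copies of `T`. -/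
def InAdd {A : Type u} [Category.{v} A] [Abelian A] [HasCoproducts.{v} A]
    (T X : A) : Prop :=
  ∃ (ι : Type v) (Y : A), Nonempty ((X ⊞ Y) ≅ ∐ (fun _ : ι => T))

lemma CategoryTheory.ShortComplex.exact_of_forall_evaluation {J C : Type*} [Category* J] [Category* C]
    [Abelian C] (S : ShortComplex (J ⥤ C))
    (hS : ∀ j, (S.map ((evaluation J C).obj j)).Exact) : S.Exact := by
  rw [ShortComplex.exact_iff_isZero_homology, Functor.isZero_iff]
  intro j
  exact ((ShortComplex.exact_iff_isZero_homology _).1 (hS j)).of_iso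
    (S.mapHomologyIso ((evaluation J C).obj j)).symm

lemma CochainComplex.acyclic_sigma {C : Type*} [Category* C] [Abelian C]
    {I : Type*} [HasCoproductsOfShape I C] [HasExactColimitsOfShape (Discrete I) C]
    (K : I → CochainComplex C ℤ) (hK : ∀ i, (K i).Acyclic) : (∐ K).Acyclic := by
  intro n
  rw [HomologicalComplex.exactAt_iff' _ (n - 1) n (n + 1) (by simp) (by simp)]
  let F := Discrete.functor K
  let S : ShortComplex (Discrete I ⥤ C) :=
    { X₁ := F ⋙ HomologicalComplex.eval _ _ (n - 1)
      X₂ := F ⋙ HomologicalComplex.eval _ _ n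
      X₃ := F ⋙ HomologicalComplex.eval _ _ (n + 1)
      f := { app j := (F.obj j).d _ _, naturality _ _ φ := (F.map φ).comm _ _ }
      g := { app j := (F.obj j).d _ _, naturality _ _ φ := (F.map φ).comm _ _ }
      zero := by ext j; exact (F.obj j).d_comp_d _ _ _ }
  have hS : S.Exact := S.exact_of_forall_evaluation (fun j ↦ by
    have := hK j.as n
    rwa [HomologicalComplex.exactAt_iff' _ (n - 1) n (n + 1) (by simp) (by simp)] at this)
  have h (m : ℤ) := isColimitOfPreserves (HomologicalComplex.eval C (.up ℤ) m)
    (colimit.isColimit F)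
  exact colim.exact_mapShortComplex hS (h _) (h _) (h _) ((∐ K).d _ _) ((∐ K).d _ _)
    (fun j ↦ (colimit.ι F j).comm _ _)
    (fun j ↦ (colimit.ι F j).comm _ _)

namespace DerivedCategory
variable {C : Type u} [Category.{v} C] [Abelian C] [HasDerivedCategory.{w} C]

lemma isZero_Q_obj_of_acyclic {K : CochainComplex C ℤ} (hK : K.Acyclic) : IsZero (Q.obj K) := by
  rw [IsZero.iff_id_eq_zero]
  have : QuasiIso (0 : K ⟶ K) := by
    rw [quasiIso_iff]
    intro i
    rw [quasiIsoAt_iff_exactAt _ _ (hK i)]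
    exact hK i
  have h : IsIso (Q.map (0 : K ⟶ K)) := inferInstance
  rw [Functor.map_zero] at h
  rw [← cancel_epi (0 : Q.obj K ⟶ Q.obj K)]
  simp

lemma acyclic_of_isZero_Q_obj {K : CochainComplex C ℤ} (hK : IsZero (Q.obj K)) : K.Acyclic :=
  fun n ↦ (HomologicalComplex.exactAt_iff_isZero_homology _ _).2
    (((homologyFunctor C n).map_isZero hK).of_iso ((homologyFunctorFactors C n).app K).symm)

lemma acyclic_mappingCocone {K L : CochainComplex C ℤ} (s : K ⟶ L) [QuasiIso s] :
    (CochainComplex.mappingCocone s).Acyclic :=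
  acyclic_of_isZero_Q_obj (Pretriangulated.Triangle.isZero₁_of_isIso₂ _
    (mappingCocone_triangle_distinguished s) (inferInstanceAs (IsIso (Q.map s))))

lemma exists_fac_of_Q_map_eq_zero {K L : CochainComplex C ℤ} (f : K ⟶ L) (hf : Q.map f = 0) :
    ∃ (N : CochainComplex C ℤ) (_ : N.Acyclic) (a : K ⟶ N) (b : N ⟶ L), a ≫ b = f := by
  have hf' : Qh.map ((HomotopyCategory.quotient _ _).map f) =
      Qh.map ((HomotopyCategory.quotient _ _).map 0) := by
    rw [← cancel_mono ((quotientCompQhIso C).hom.app L)]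
    simp [hf]
  rw [MorphismProperty.map_eq_iff_postcomp Qh (HomotopyCategory.quasiIso C _)] at hf'
  obtain ⟨L', s, hs, fac⟩ := hf'
  obtain ⟨L', rfl⟩ := HomotopyCategory.quotient_obj_surjective L'
  obtain ⟨s, rfl⟩ := (HomotopyCategory.quotient _ _).map_surjective s
  rw [HomotopyCategory.quotient_map_mem_quasiIso_iff] at hs
  have hs' : QuasiIso s := hs
  obtain ⟨z, hz⟩ := CochainComplex.HomComplex.Cochain.equivHomotopy _ _
    (HomotopyCategory.homotopyOfEq (f ≫ s) 0 (by simpa using fac))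
  refine ⟨CochainComplex.mappingCocone s, acyclic_mappingCocone s,
    CochainComplex.mappingCocone.lift s f (-z) (by simp [hz]),
    CochainComplex.mappingCocone.fst s, by simp⟩

lemma eq_zero_of_Q_map_sigma_ι {I : Type*} [HasCoproductsOfShape I C]
    [HasExactColimitsOfShape (Discrete I) C] (K : I → CochainComplex C ℤ)
    {W : DerivedCategory C} (φ : Q.obj (∐ K) ⟶ W)
    (hφ : ∀ i, Q.map (Sigma.ι K i) ≫ φ = 0) : φ = 0 := by
  obtain ⟨L, ⟨e⟩⟩ : ∃ L, Nonempty (W ≅ Q.obj L) := ⟨_, ⟨(Q.objObjPreimageIso W).symm⟩⟩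
  obtain ⟨L', g, s, _, hg⟩ := left_fac (φ ≫ e.hom)
  suffices Q.map g = 0 by
    rw [this, zero_comp] at hg
    exact zero_of_comp_mono e.hom hg
  have hg' : Q.map g = φ ≫ e.hom ≫ Q.map s := by simp [reassoc_of% hg]
  choose N hN a b fac using fun i ↦ exists_fac_of_Q_map_eq_zero (Sigma.ι K i ≫ g)
    (by simp [hg', reassoc_of% (hφ i)])
  have : g = Limits.Sigma.map a ≫ Limits.Sigma.desc b :=
    Limits.Sigma.hom_ext _ _ (by simp [fac])
  rw [this, Functor.map_comp]
  rw [(isZero_Q_obj_of_acyclic (CochainComplex.acyclic_sigma N hN)).eq_zero_of_tgt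
    (Q.map (Limits.Sigma.map a)), zero_comp]
end DerivedCategory

lemma CategoryTheory.Retract.subsingleton_hom {C : Type*} [Category* C] {X X' Y Y' : C}
    (h : Retract X X') (h' : Retract Y Y') (H : Subsingleton (X' ⟶ Y')) :
    Subsingleton (X ⟶ Y) := by
  refine ⟨fun f g ↦ ?_⟩
  have := Subsingleton.elim (h.r ≫ f ≫ h'.i) (h.r ≫ g ≫ h'.i)
  simpa using h.i ≫= this =≫ h'.r

namespace InAdd
variable {A : Type u} [Category.{v} A] [Abelian A] [HasCoproducts.{v} A] {T X Y : A}

lemma exists_retract (h : InAdd T X) : ∃ ι : Type v, Nonempty (Retract X (∐ fun _ : ι ↦ T)) := by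
  obtain ⟨ι, Y, ⟨e⟩⟩ := h
  exact ⟨ι, ⟨{ i := biprod.inl ≫ e.hom, r := e.inv ≫ biprod.fst }⟩⟩

lemma of_iso (h : InAdd T X) (e : X ≅ Y) : InAdd T Y := by
  obtain ⟨ι, Z, ⟨e'⟩⟩ := h
  exact ⟨ι, Z, ⟨biprod.mapIso e.symm (Iso.refl Z) ≪≫ e'⟩⟩

lemma of_isZero (T : A) (hX : IsZero X) : InAdd T X :=
  ⟨PEmpty, ∐ fun _ : PEmpty.{v + 1} ↦ T, ⟨biprod.braiding _ _ ≪≫ (isoBiprodZero hX).symm⟩⟩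

end InAdd

namespace DerivedCategory
variable {A : Type u} [Category.{v} A] [Abelian A] [HasDerivedCategory.{w} A]

lemma subsingleton_hom_single_of_lt (S Z : A) {a b : ℤ} (hab : a < b) :
    Subsingleton ((singleFunctor A a).obj S ⟶ (singleFunctor A b).obj Z) :=
  subsingleton_hom_of_isStrictlyLE_of_isStrictlyGE
    ((CochainComplex.singleFunctor A a).obj S) ((CochainComplex.singleFunctor A b).obj Z) a b hab

lemma subsingleton_hom_single_of_ext [HasExt.{w} A] (S Z : A) (a b : ℤ) (n : ℕ) (h : a = b + n)
    (H : Subsingleton (Abelian.Ext S Z n)) :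
    Subsingleton ((singleFunctor A a).obj S ⟶ (singleFunctor A b).obj Z) := by
  let e₁ : ((singleFunctor A 0).obj S)⟦-a⟧ ≅ (singleFunctor A a).obj S :=
    ((singleFunctors A).shiftIso (-a) a 0 (by simp)).app S
  let e₂ : ((singleFunctor A (-n)).obj Z)⟦-a⟧ ≅ (singleFunctor A b).obj Z :=
    ((singleFunctors A).shiftIso (-a) b (-n) (by lia)).app Z
  let e₃ : ((singleFunctor A 0).obj Z)⟦(n : ℤ)⟧ ≅ (singleFunctor A (-n)).obj Z :=
    ((singleFunctors A).shiftIso n (-n) 0 (by simp)).app Z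
  have : Subsingleton ((singleFunctor A 0).obj S ⟶ ((singleFunctor A 0).obj Z)⟦(n : ℤ)⟧) :=
    (Abelian.Ext.homEquiv (X := S) (Y := Z) (n := n)).symm.subsingleton
  exact (e₁.homCongr ((shiftFunctor _ (-a)).mapIso e₃ ≪≫ e₂)).symm.subsingleton_congr.2
    ((Functor.FullyFaithful.ofFullyFaithful
      (shiftFunctor (DerivedCategory A) (-a))).homEquiv.subsingleton_congr.1 this)

variable [HasCoproducts.{v} A] [AB4 A] [HasExt.{w} A] {T : A}

lemma subsingleton_hom_single_of_inAdd
    (hT : ∀ (I : Type v) (i : ℕ), 0 < i → Subsingleton (Abelian.Ext T (∐ (fun _ : I => T)) i))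
    {S Z : A} (hS : InAdd T S) (hZ : InAdd T Z) {a b : ℤ} (hab : a ≠ b) :
    Subsingleton ((singleFunctor A a).obj S ⟶ (singleFunctor A b).obj Z) := by
  obtain hab | hab := hab.lt_or_gt
  · exact subsingleton_hom_single_of_lt S Z hab
  obtain ⟨I, ⟨rS⟩⟩ := hS.exists_retract
  obtain ⟨J, ⟨rZ⟩⟩ := hZ.exists_retract
  refine (rS.map (singleFunctor A a)).subsingleton_hom (rZ.map (singleFunctor A b)) ?_
  obtain ⟨n, hn⟩ := Int.le.dest hab.le
  have hJ := subsingleton_hom_single_of_ext T _ a b n hn.symm (hT J n (by lia))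
  let F := HomologicalComplex.single A (.up ℤ) a
  suffices Subsingleton (Q.obj (∐ fun _ : I ↦ F.obj T) ⟶
      (singleFunctor A b).obj (∐ fun _ : J ↦ T)) from
    ((Q.mapIso (PreservesCoproduct.iso F (fun _ : I ↦ T))).homCongr
      (Iso.refl _)).subsingleton_congr.2 this
  refine subsingleton_of_forall_eq 0 fun φ ↦ ?_
  exact eq_zero_of_Q_map_sigma_ι _ _ (fun i ↦ hJ.elim _ _)

end DerivedCategory

namespace CategoryTheory.Functor
open Pretriangulated
variable {C D : Type*} [Category* C] [Category* D]

/-- A functor is bijective on the morphisms `X ⟶ Y`. -/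
def BijectiveOn (F : C ⥤ D) (X Y : C) : Prop :=
  Function.Bijective (F.map : (X ⟶ Y) → (F.obj X ⟶ F.obj Y))

variable {F : C ⥤ D}

lemma BijectiveOn.of_iso {X X' Y Y' : C} (h : F.BijectiveOn X Y) (e : X ≅ X') (e' : Y ≅ Y') :
    F.BijectiveOn X' Y' := by
  refine ⟨fun f g hfg ↦ ?_, fun φ ↦ ?_⟩
  · have := h.1 (a₁ := e.hom ≫ f ≫ e'.inv) (a₂ := e.hom ≫ g ≫ e'.inv) (by simp [hfg])
    simpa using e.inv ≫= this =≫ e'.hom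
  · obtain ⟨f, hf⟩ := h.2 (F.map e.hom ≫ φ ≫ F.map e'.inv)
    exact ⟨e.inv ≫ f ≫ e'.hom, by simp [hf, ← F.map_comp_assoc, ← F.map_comp]⟩

variable [HasZeroObject C] [HasShift C ℤ] [Preadditive C]
  [∀ n : ℤ, (shiftFunctor C n).Additive] [Pretriangulated C]
  [HasZeroObject D] [HasShift D ℤ] [Preadditive D]
  [∀ n : ℤ, (shiftFunctor D n).Additive] [Pretriangulated D]
  [F.CommShift ℤ] [F.IsTriangulated]

lemma map_coyoneda_exact₂ {T : Triangle C} (hT : T ∈ distTriang C) {X : D}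
    (φ : X ⟶ F.obj T.obj₂) (hφ : φ ≫ F.map T.mor₂ = 0) :
    ∃ ψ : X ⟶ F.obj T.obj₁, φ = ψ ≫ F.map T.mor₁ :=
  Triangle.coyoneda_exact₂ _ (F.map_distinguished _ hT) φ hφ

lemma map_yoneda_exact₂ {T : Triangle C} (hT : T ∈ distTriang C) {Y : D}
    (φ : F.obj T.obj₂ ⟶ Y) (hφ : F.map T.mor₁ ≫ φ = 0) :
    ∃ ψ : F.obj T.obj₃ ⟶ Y, φ = F.map T.mor₂ ≫ ψ :=
  Triangle.yoneda_exact₂ _ (F.map_distinguished _ hT) φ hφ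

lemma bijectiveOn_coyoneda_obj₂ (T : Triangle C) (hT : T ∈ distTriang C) (X : C)
    (h₀ : F.BijectiveOn X (T.obj₃⟦(-1 : ℤ)⟧)) (h₁ : F.BijectiveOn X T.obj₁)
    (h₃ : F.BijectiveOn X T.obj₃) (h₄ : F.BijectiveOn X (T.obj₁⟦(1 : ℤ)⟧)) :
    F.BijectiveOn X T.obj₂ := by
  obtain ⟨δ, μ, hδ⟩ : ∃ (δ : T.obj₃⟦(-1 : ℤ)⟧ ⟶ T.obj₁) (μ : _),
      Triangle.mk δ T.mor₁ μ ∈ distTriang C :=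
    ⟨_, _, inv_rot_of_distTriang _ hT⟩
  have hδ₀ : δ ≫ T.mor₁ = 0 := comp_distTriang_mor_zero₁₂ _ hδ
  refine ⟨(injective_iff_map_eq_zero (F.mapAddHom (X := X) (Y := T.obj₂))).2
    fun f (hf : F.map f = 0) ↦ ?_, fun φ ↦ ?_⟩
  · obtain ⟨g, rfl⟩ := Triangle.coyoneda_exact₂ T hT f (h₃.1 (by simp [hf]))
    obtain ⟨h, hh⟩ : ∃ h, F.map g = h ≫ F.map δ :=
      map_coyoneda_exact₂ hδ (F.map g) ((F.map_comp _ _).symm.trans hf)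
    obtain ⟨h, rfl⟩ := h₀.2 h
    obtain rfl : g = h ≫ δ := h₁.1 (by simpa using hh)
    rw [Category.assoc, hδ₀, comp_zero]
  · obtain ⟨u, hu⟩ := h₃.2 (φ ≫ F.map T.mor₂)
    have hu₀ : u ≫ T.mor₃ = 0 := h₄.1 (by
      rw [F.map_comp, hu, Category.assoc, ← F.map_comp, comp_distTriang_mor_zero₂₃ _ hT]
      simp)
    obtain ⟨v, rfl⟩ := Triangle.coyoneda_exact₃ T hT u hu₀
    obtain ⟨ψ, hψ⟩ := map_coyoneda_exact₂ hT (φ - F.map v) (by simp [← hu])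
    obtain ⟨t, rfl⟩ := h₁.2 ψ
    exact ⟨v + t ≫ T.mor₁, by simp [← hψ]⟩

lemma bijectiveOn_yoneda_obj₂ (T : Triangle C) (hT : T ∈ distTriang C) (Y : C)
    (h₀ : F.BijectiveOn (T.obj₃⟦(-1 : ℤ)⟧) Y) (h₁ : F.BijectiveOn T.obj₁ Y)
    (h₃ : F.BijectiveOn T.obj₃ Y) (h₄ : F.BijectiveOn (T.obj₁⟦(1 : ℤ)⟧) Y) :
    F.BijectiveOn T.obj₂ Y := by
  obtain ⟨δ, μ, hδ⟩ : ∃ (δ : T.obj₃⟦(-1 : ℤ)⟧ ⟶ T.obj₁) (μ : _),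
      Triangle.mk δ T.mor₁ μ ∈ distTriang C :=
    ⟨_, _, inv_rot_of_distTriang _ hT⟩
  have hδ₀ : δ ≫ T.mor₁ = 0 := comp_distTriang_mor_zero₁₂ _ hδ
  refine ⟨(injective_iff_map_eq_zero (F.mapAddHom (X := T.obj₂) (Y := Y))).2
    fun f (hf : F.map f = 0) ↦ ?_, fun φ ↦ ?_⟩
  · obtain ⟨g, rfl⟩ := Triangle.yoneda_exact₂ T hT f (h₁.1 (by simp [hf]))
    obtain ⟨h, hh⟩ : ∃ h, F.map g = F.map T.mor₃ ≫ h :=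
      map_yoneda_exact₂ (rot_of_distTriang _ hT) (F.map g) ((F.map_comp _ _).symm.trans hf)
    obtain ⟨h, rfl⟩ := h₄.2 h
    obtain rfl : g = T.mor₃ ≫ h := h₃.1 (by simpa using hh)
    rw [comp_distTriang_mor_zero₂₃_assoc _ hT, zero_comp]
  · obtain ⟨u, hu⟩ := h₁.2 (F.map T.mor₁ ≫ φ)
    have hu₀ : δ ≫ u = 0 := h₀.1 (by
      rw [F.map_comp, hu, ← F.map_comp_assoc, hδ₀]
      simp)
    obtain ⟨v, rfl⟩ : ∃ v, u = T.mor₁ ≫ v := Triangle.yoneda_exact₂ _ hδ u hu₀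
    obtain ⟨ψ, hψ⟩ := map_yoneda_exact₂ hT (φ - F.map v) (by simp [← hu])
    obtain ⟨t, rfl⟩ := h₃.2 ψ
    exact ⟨v + T.mor₂ ≫ t, by simp [← hψ]⟩

lemma bijectiveOn_shift_coyoneda_obj₂ (T : Triangle C) (hT : T ∈ distTriang C) (X : C)
    (h₁ : ∀ n : ℤ, F.BijectiveOn X (T.obj₁⟦n⟧)) (h₃ : ∀ n : ℤ, F.BijectiveOn X (T.obj₃⟦n⟧))
    (n : ℤ) : F.BijectiveOn X (T.obj₂⟦n⟧) :=
  bijectiveOn_coyoneda_obj₂ _ (Triangle.shift_distinguished _ hT n) X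
    ((h₃ (n - 1)).of_iso (Iso.refl _) ((shiftFunctorAdd' C n (-1) (n - 1) (by lia)).app _))
    (h₁ n) (h₃ n)
    ((h₁ (n + 1)).of_iso (Iso.refl _) ((shiftFunctorAdd' C n 1 (n + 1) (by lia)).app _))

lemma bijectiveOn_shift_yoneda_obj₂ (T : Triangle C) (hT : T ∈ distTriang C) (Y : C)
    (h₁ : ∀ n : ℤ, F.BijectiveOn (T.obj₁⟦n⟧) Y) (h₃ : ∀ n : ℤ, F.BijectiveOn (T.obj₃⟦n⟧) Y)
    (n : ℤ) : F.BijectiveOn (T.obj₂⟦n⟧) Y :=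
  bijectiveOn_yoneda_obj₂ _ (Triangle.shift_distinguished _ hT n) Y
    ((h₃ (n - 1)).of_iso ((shiftFunctorAdd' C n (-1) (n - 1) (by lia)).app _) (Iso.refl _))
    (h₁ n) (h₃ n)
    ((h₁ (n + 1)).of_iso ((shiftFunctorAdd' C n 1 (n + 1) (by lia)).app _) (Iso.refl _))

end CategoryTheory.Functor

namespace CochainComplex
open HomologicalComplex
variable {A : Type*} [Category* A] [Abelian A]

/-- The inclusion of the top term of a complex `K` vanishing in degrees `> b`, and its cokernel. -/
noncomputable def topShortComplex (K : CochainComplex A ℤ) (b : ℤ)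
    (hK : ∀ i, b < i → IsZero (K.X i)) : ShortComplex (CochainComplex A ℤ) :=
  .mk (mkHomFromSingle (𝟙 (K.X b))
      (fun i hi ↦ (hK i (by have : b + 1 = i := hi; lia)).eq_of_tgt _ _))
    (cokernel.π _) (cokernel.condition _)

section
variable (K : CochainComplex A ℤ) (b : ℤ) (hK : ∀ i, b < i → IsZero (K.X i))

lemma isIso_topShortComplex_f : IsIso ((topShortComplex K b hK).f.f b) := by
  dsimp [topShortComplex]
  rw [mkHomFromSingle_f]
  infer_instance

instance epi_topShortComplex_g (i : ℤ) : Epi ((topShortComplex K b hK).g.f i) :=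
  inferInstanceAs (Epi ((cokernel.π (topShortComplex K b hK).f).f i))

lemma isZero_topShortComplex_X₁ (i : ℤ) (hi : i ≠ b) :
    IsZero ((topShortComplex K b hK).X₁.X i) :=
  isZero_single_obj_X _ _ _ _ hi

lemma isZero_topShortComplex_X₃ : IsZero ((topShortComplex K b hK).X₃.X b) := by
  have := isIso_topShortComplex_f K b hK
  refine IsZero.of_epi_eq_zero ((topShortComplex K b hK).g.f b) ?_
  rw [← cancel_epi ((topShortComplex K b hK).f.f b), ← comp_f, ShortComplex.zero]
  simp

lemma isIso_topShortComplex_g (i : ℤ) (hi : i ≠ b) :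
    IsIso ((topShortComplex K b hK).g.f i) := by
  have h : (topShortComplex K b hK).Exact := ShortComplex.exact_cokernel _
  have : Mono ((topShortComplex K b hK).g.f i) :=
    (h.map (eval A _ i)).mono_g ((isZero_topShortComplex_X₁ K b hK i hi).eq_of_src _ _)
  exact isIso_of_mono_of_epi _

open Classical in
/-- The short complex `topShortComplex` is degreewise split. -/
noncomputable def topShortComplexSplitting (i : ℤ) :
    ((topShortComplex K b hK).map (eval A _ i)).Splitting :=
  if hi : i = b then
    .ofIsIsoOfIsZero _ (by subst hi; exact isIso_topShortComplex_f K _ hK)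
      (by subst hi; exact isZero_topShortComplex_X₃ K _ hK)
  else
    .ofIsZeroOfIsIso _ (isZero_topShortComplex_X₁ K b hK i hi)
      (isIso_topShortComplex_g K b hK i hi)

end
end CochainComplex

namespace HomotopyCategory
open Pretriangulated
variable {A : Type*} [Category* A] [Abelian A]

lemma quotient_obj_mem_of_bounded
    (P : ObjectProperty (HomotopyCategory A (.up ℤ))) [P.IsClosedUnderIsomorphisms]
    (hP : ∀ T ∈ distTriang (HomotopyCategory A (.up ℤ)), P T.obj₁ → P T.obj₃ → P T.obj₂)
    (p : ObjectProperty A) [p.IsClosedUnderIsomorphisms] (hp₀ : ∀ Z, IsZero Z → p Z)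
    (hp : ∀ Z b, p Z → P ((quotient A (.up ℤ)).obj ((HomologicalComplex.single A _ b).obj Z)))
    (K : CochainComplex A ℤ) (hK : ∀ i, p (K.X i))
    (hb : ∃ a b : ℤ, ∀ i : ℤ, (i < a ∨ b < i) → IsZero (K.X i)) :
    P ((quotient A (.up ℤ)).obj K) := by
  obtain ⟨a, b, h⟩ := hb
  suffices H : ∀ (N : ℕ) (K : CochainComplex A ℤ), (∀ i, p (K.X i)) →
      (∀ i, (i < a ∨ a + N ≤ i) → IsZero (K.X i)) → P ((quotient A (.up ℤ)).obj K) from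
    H (b + 1 - a).toNat K hK (fun i hi ↦ h i (by lia))
  intro N
  induction N with
  | zero =>
    intro K hK h
    refine P.prop_of_iso ((quotient A _).mapIso
      (IsZero.iso (Functor.map_isZero _ (h a (by simp))) ?_)) (hp _ 0 (hK a))
    rw [IsZero.iff_id_eq_zero]
    ext i
    exact (h i (by lia)).eq_of_src _ _
  | succ N ih =>
    intro K hK h
    have h' (i : ℤ) (hi : a + N < i) : IsZero (K.X i) := h i (by lia)
    let S := CochainComplex.topShortComplex K (a + N) h'
    have hS₃ : IsZero (S.X₃.X (a + N)) := CochainComplex.isZero_topShortComplex_X₃ _ _ _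
    have e (i : ℤ) (hi : i ≠ a + N) : IsIso (S.g.f i) :=
      CochainComplex.isIso_topShortComplex_g _ _ _ i hi
    have hT := (distinguished_iff_iso_trianglehOfDegreewiseSplit _).2
      ⟨S, CochainComplex.topShortComplexSplitting K (a + N) h', ⟨Iso.refl _⟩⟩
    refine hP _ hT (hp _ (a + N) (hK _)) (ih S.X₃ (fun i ↦ ?_) (fun i hi ↦ ?_))
    · by_cases hi : i = a + N
      · exact hp₀ _ (hi ▸ hS₃)
      · have := e i hi
        exact p.prop_of_iso (asIso (S.g.f i)) (hK i)
    · by_cases hi' : i = a + N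
      · exact hi' ▸ hS₃
      · have := e i hi'
        exact (h i (by lia)).of_iso (asIso (S.g.f i)).symm

end HomotopyCategory

namespace DerivedCategory
variable {A : Type u} [Category.{v} A] [Abelian A] [HasDerivedCategory.{w} A]
  [HasCoproducts.{v} A] [AB4 A] [HasExt.{w} A] {T : A}

lemma Qh_bijectiveOn_single
    (hT : ∀ (I : Type v) (i : ℕ), 0 < i → Subsingleton (Abelian.Ext T (∐ (fun _ : I => T)) i))
    {S Z : A} (hS : InAdd T S) (hZ : InAdd T Z) (a b : ℤ) :
    Qh.BijectiveOn ((HomotopyCategory.singleFunctor A a).obj S)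
      ((HomotopyCategory.singleFunctor A b).obj Z) := by
  by_cases hab : a = b
  · subst hab
    have h : Function.Bijective ((singleFunctor A a).map : (S ⟶ Z) → _) :=
      (Functor.FullyFaithful.ofFullyFaithful (singleFunctor A a)).map_bijective S Z
    have h' : Function.Surjective ((HomotopyCategory.singleFunctor A a).map : (S ⟶ Z) → _) :=
        fun φ ↦ by
      obtain ⟨φ, rfl⟩ := (HomotopyCategory.quotient _ _).map_surjective φ
      obtain ⟨f, rfl⟩ := (CochainComplex.singleFunctor A a).map_surjective φ
      exact ⟨f, rfl⟩
    have h'' : Function.Bijective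
        (Qh.map ∘ ((HomotopyCategory.singleFunctor A a).map : (S ⟶ Z) → _)) := h
    exact ⟨h''.1.of_comp_right h', h''.2.of_comp⟩
  · have := subsingleton_hom_single_of_inAdd hT hS hZ hab
    have hD : Subsingleton (Qh.obj ((HomotopyCategory.singleFunctor A a).obj S) ⟶
      Qh.obj ((HomotopyCategory.singleFunctor A b).obj Z)) := this
    have hK : ∀ f : (HomotopyCategory.singleFunctor A a).obj S ⟶
        (HomotopyCategory.singleFunctor A b).obj Z, f = 0 := fun f ↦ by
      obtain ⟨f, rfl⟩ := (HomotopyCategory.quotient _ _).map_surjective f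
      have : f = 0 := by
        ext i
        by_cases hi : i = a
        · exact (HomologicalComplex.isZero_single_obj_X _ _ _ _ (by lia)).eq_of_tgt _ _
        · exact (HomologicalComplex.isZero_single_obj_X _ _ _ _ hi).eq_of_src _ _
      rw [this, Functor.map_zero]
      rfl
    exact ⟨fun f g _ ↦ (hK f).trans (hK g).symm, fun φ ↦ ⟨0, hD.elim _ _⟩⟩

lemma Qh_bijectiveOn_shift_single
    (hT : ∀ (I : Type v) (i : ℕ), 0 < i → Subsingleton (Abelian.Ext T (∐ (fun _ : I => T)) i))
    {S Z : A} (hS : InAdd T S) (hZ : InAdd T Z) (a b m n : ℤ) :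
    Qh.BijectiveOn (((HomotopyCategory.singleFunctor A a).obj S)⟦m⟧)
      (((HomotopyCategory.singleFunctor A b).obj Z)⟦n⟧) :=
  (Qh_bijectiveOn_single hT hS hZ (a - m) (b - n)).of_iso
    (((HomotopyCategory.singleFunctors A).shiftIso m (a - m) a (by lia)).symm.app S)
    (((HomotopyCategory.singleFunctors A).shiftIso n (b - n) b (by lia)).symm.app Z)

end DerivedCategory

/-- if `A` is an abelian category with exact set-indexed coproducts and
`T ∈ A` satisfies `Ext^i_A(T, T^{(I)}) = 0` for all `i > 0` and all sets `I`, then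
the composition `Hot^b(Add(T)) → Hot^b(A) → D^b(A)` is fully faithful: for bounded
complexes `X•`, `Y•` with terms in `Add(T)`, the map
`Hom_{Hot}(X•, Y•) → Hom_{D}(X•, Y•)` is bijective. -/
theorem statement1 (A : Type u) [Category.{v} A] [Abelian A]
    [HasCoproducts.{v} A] [AB4 A] [HasDerivedCategory.{w} A]
    (T : A) [HasExt.{w} A]
    (hT : ∀ (I : Type v) (i : ℕ), 0 < i →
      Subsingleton (Abelian.Ext T (∐ (fun _ : I => T)) i))
    (X Y : CochainComplex A ℤ)
    (hXb : ∃ a b : ℤ, ∀ i : ℤ, (i < a ∨ b < i) → IsZero (X.X i))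
    (hYb : ∃ a b : ℤ, ∀ i : ℤ, (i < a ∨ b < i) → IsZero (Y.X i))
    (hXAdd : ∀ i : ℤ, InAdd T (X.X i)) (hYAdd : ∀ i : ℤ, InAdd T (Y.X i)) :
    Function.Bijective (fun f :
        ((HomotopyCategory.quotient A (ComplexShape.up ℤ)).obj X ⟶
          (HomotopyCategory.quotient A (ComplexShape.up ℤ)).obj Y) =>
      DerivedCategory.Qh.map f) := by
  let p : ObjectProperty A := InAdd T
  have : p.IsClosedUnderIsomorphisms := ⟨fun e h ↦ InAdd.of_iso h e⟩
  have hp₀ (Z : A) (hZ : IsZero Z) : p Z := InAdd.of_isZero T hZ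
  let PY (X : HomotopyCategory A (.up ℤ)) : ObjectProperty (HomotopyCategory A (.up ℤ)) :=
    fun Y ↦ ∀ n : ℤ, DerivedCategory.Qh.BijectiveOn X (Y⟦n⟧)
  have (X : _) : (PY X).IsClosedUnderIsomorphisms :=
    ⟨fun e h n ↦ (h n).of_iso (Iso.refl _) ((shiftFunctor _ n).mapIso e)⟩
  let PX (Y : HomotopyCategory A (.up ℤ)) : ObjectProperty (HomotopyCategory A (.up ℤ)) :=
    fun X ↦ ∀ n : ℤ, DerivedCategory.Qh.BijectiveOn (X⟦n⟧) Y
  have (Y : _) : (PX Y).IsClosedUnderIsomorphisms :=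
    ⟨fun e h n ↦ (h n).of_iso ((shiftFunctor _ n).mapIso e) (Iso.refl _)⟩
  have hX (n : ℤ) := HomotopyCategory.quotient_obj_mem_of_bounded
    (PX (((HomotopyCategory.quotient A (.up ℤ)).obj Y)⟦n⟧))
    (fun T hT ↦ Functor.bijectiveOn_shift_yoneda_obj₂ T hT _) p hp₀ (fun S a hS m ↦
      HomotopyCategory.quotient_obj_mem_of_bounded (PY _)
        (fun T hT ↦ Functor.bijectiveOn_shift_coyoneda_obj₂ T hT _) p hp₀
        (fun Z b hZ n ↦ DerivedCategory.Qh_bijectiveOn_shift_single hT hS hZ a b m n)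
        Y hYAdd hYb n) X hXAdd hXb
  exact (hX 0 0).of_iso ((shiftFunctorZero _ ℤ).app _) ((shiftFunctorZero _ ℤ).app _)
end

section
/- Let A be a complete, cocomplete abelian category with an injective cogenerator W, and let T ∈ A have projective dimension at most n. Then every object X ∈ A admits an exact sequence 0 → X → E^0 → E^1 → ⋯ → E^n → 0 in A with all E^i belonging to E = {E ∈ A : Ext^i_A(T, E) = 0 for all i > 0}. -/
open CategoryTheory Limits

universe w v u

/-- An abelian category with products and an injective coseparator has enough injectives. -/
lemma enoughInjectives_of_isCoseparator {A : Type u} [Category.{v} A] [Abelian A] [HasLimits A]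
    {W : A} [Injective W] (hW : IsCoseparator W) : EnoughInjectives A where
  presentation X :=
    ⟨{ J := ∏ᶜ fun _ : X ⟶ W => W
       f := Pi.lift fun g : X ⟶ W => g
       mono := (isCoseparator_iff_mono W).1 hW X }⟩

/-- Dimension shifting: the cokernel of a monomorphism from `X` to an injective object has
vanishing `Ext T _ j` as soon as `Ext T X (j + 1)` vanishes. -/
lemma CategoryTheory.ShortComplex.ShortExact.subsingleton_ext_of_injective
    {A : Type u} [Category.{v} A] [Abelian A] [HasExt.{w} A] {S : ShortComplex A}
    (hS : S.ShortExact) [Injective S.X₂] (T : A) {j : ℕ} (hj : 0 < j)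
    [Subsingleton (Abelian.Ext T S.X₁ (j + 1))] : Subsingleton (Abelian.Ext T S.X₃ j) := by
  obtain ⟨j, rfl⟩ := Nat.exists_eq_add_of_lt hj
  refine subsingleton_of_forall_eq 0 fun x => ?_
  obtain ⟨y, rfl⟩ := Abelian.Ext.covariant_sequence_exact₃ T hS x rfl (Subsingleton.elim _ _)
  rw [Abelian.Ext.eq_zero_of_injective y, Abelian.Ext.zero_comp]

open ZeroObject in
/-- In an abelian category with enough injectives, an object `X` with `Ext T X j = 0` for `j > n`
has a coresolution of length `n` by objects `E` with `Ext T E j = 0` for `j > 0`. -/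
lemma exists_coresolution_of_subsingleton_ext {A : Type u} [Category.{v} A] [Abelian A]
    [HasExt.{w} A] [EnoughInjectives A] (T : A) (n : ℕ) (X : A)
    (hX : ∀ j : ℕ, n < j → Subsingleton (Abelian.Ext T X j)) :
    ∃ (E : ℕ → A) (f : X ⟶ E 0) (d : ∀ i : ℕ, E i ⟶ E (i + 1))
      (hw0 : f ≫ d 0 = 0) (hw : ∀ i : ℕ, d i ≫ d (i + 1) = 0),
      (∀ i : ℕ, i ≤ n → ∀ j : ℕ, 0 < j → Subsingleton (Abelian.Ext T (E i) j)) ∧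
      (∀ i : ℕ, n < i → IsZero (E i)) ∧
      Mono f ∧
      (ShortComplex.mk f (d 0) hw0).Exact ∧
      (∀ i : ℕ, (ShortComplex.mk (d i) (d (i + 1)) (hw i)).Exact) := by
  induction n generalizing X with
  | zero =>
    let E : ℕ → A := fun i => match i with
      | 0 => X
      | _ + 1 => 0
    have hE : ∀ i, IsZero (E (i + 1)) := fun _ => isZero_zero A
    refine ⟨E, 𝟙 X, fun _ => 0, comp_zero, fun _ => comp_zero, ?_, ?_, inferInstance, ?_, ?_⟩
    · rintro i hi j hj
      obtain rfl : i = 0 := by lia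
      exact hX j hj
    · rintro (_ | i) hi
      · lia
      · exact hE i
    · exact (ShortComplex.exact_iff_epi _ rfl).2 (inferInstanceAs (Epi (𝟙 X)))
    · exact fun i => ShortComplex.exact_of_isZero_X₂ _ (hE i)
  | succ n ih =>
    let S := ShortComplex.mk (Injective.ι X) (cokernel.π (Injective.ι X)) (cokernel.condition _)
    have hS : S.ShortExact :=
      { exact := ShortComplex.exact_cokernel _
        mono_f := inferInstanceAs (Mono (Injective.ι X))
        epi_g := inferInstanceAs (Epi (cokernel.π _)) }
    have : Injective S.X₂ := inferInstanceAs (Injective (Injective.under X))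
    have : Epi S.g := hS.epi_g
    obtain ⟨E, f, d, hw0, hw, hE, hE0, hf, h0, h⟩ := ih S.X₃ fun j hj =>
      have : Subsingleton (Abelian.Ext T S.X₁ (j + 1)) := hX (j + 1) (by lia)
      hS.subsingleton_ext_of_injective T (by lia)
    let E' : ℕ → A := fun i => match i with
      | 0 => S.X₂
      | i + 1 => E i
    let d' : ∀ i, E' i ⟶ E' (i + 1) := fun i => match i with
      | 0 => S.g ≫ f
      | i + 1 => d i
    have hw0' : S.f ≫ S.g ≫ f = 0 := by rw [S.zero_assoc, zero_comp]
    have hw1' : (S.g ≫ f) ≫ d 0 = 0 := by rw [Category.assoc, hw0, comp_zero]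
    refine ⟨E', S.f, d', hw0', ?_, ?_, ?_, hS.mono_f, ?_, ?_⟩
    · rintro (_ | i)
      · exact hw1'
      · exact hw i
    · rintro (_ | i) hi (_ | j) hj
      · lia
      · exact Abelian.Ext.subsingleton_of_injective T S.X₂ j
      · lia
      · exact hE i (by lia) _ hj
    · rintro (_ | i) hi
      · lia
      · exact hE0 i (by lia)
    · let φ : S ⟶ ShortComplex.mk S.f (S.g ≫ f) hw0' := { τ₁ := 𝟙 _, τ₂ := 𝟙 _, τ₃ := f }
      have : Epi φ.τ₁ := inferInstanceAs (Epi (𝟙 _))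
      have : IsIso φ.τ₂ := inferInstanceAs (IsIso (𝟙 _))
      have : Mono φ.τ₃ := hf
      exact (ShortComplex.exact_iff_of_epi_of_isIso_of_mono φ).1 hS.exact
    · rintro (_ | i)
      · let φ : ShortComplex.mk (S.g ≫ f) (d 0) hw1' ⟶ ShortComplex.mk f (d 0) hw0 :=
          { τ₁ := S.g, τ₂ := 𝟙 _, τ₃ := 𝟙 _ }
        have : Epi φ.τ₁ := hS.epi_g
        have : IsIso φ.τ₂ := inferInstanceAs (IsIso (𝟙 _))
        have : Mono φ.τ₃ := inferInstanceAs (Mono (𝟙 _))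
        exact (ShortComplex.exact_iff_of_epi_of_isIso_of_mono φ).2 h0
      · exact h i

/-- let `A` be a complete, cocomplete abelian category with an injective
cogenerator `W`, and let `T ∈ A` have projective dimension at most `n`.  Then every
object `X` admits an exact sequence `0 → X → E^0 → E^1 → ⋯ → E^n → 0` with all
`E^i ∈ E = {E : Ext^i_A(T,E) = 0 for all i > 0}`.  (We encode the finite exact
sequence by an `ℕ`-indexed sequence which vanishes in degrees `> n`.) -/
theorem statement3 (A : Type u) [Category.{v} A] [Abelian A]
    [HasLimits A] [HasColimits A] [HasExt.{w} A]
    (W : A) (hW : Injective W ∧ IsCoseparator W)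
    (T : A) (n : ℕ)
    (hT : ∀ (i : ℕ), n < i → ∀ X : A, Subsingleton (Abelian.Ext T X i))
    (X : A) :
    ∃ (E : ℕ → A) (f : X ⟶ E 0) (d : ∀ i : ℕ, E i ⟶ E (i + 1))
      (hw0 : f ≫ d 0 = 0) (hw : ∀ i : ℕ, d i ≫ d (i + 1) = 0),
      -- the terms in degrees `0,…,n` lie in the class `E`
      (∀ i : ℕ, i ≤ n → ∀ j : ℕ, 0 < j → Subsingleton (Abelian.Ext T (E i) j)) ∧
      -- the sequence stops after degree `n`
      (∀ i : ℕ, n < i → IsZero (E i)) ∧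
      -- exactness of `0 → X → E^0 → E^1 → ⋯`
      Mono f ∧
      (ShortComplex.mk f (d 0) hw0).Exact ∧
      (∀ i : ℕ, (ShortComplex.mk (d i) (d (i + 1)) (hw i)).Exact) := by
  have := hW.1
  have := enoughInjectives_of_isCoseparator hW.2
  exact exists_coresolution_of_subsingleton_ext T n X fun i hi => hT i hi X
end

section
/- Let R be a commutative ring and S ⊂ R a multiplicative subset consisting of nonzero-divisors such that the R-module S^{-1}R has projective dimension at most 1. Then Ext^1_R(S^{-1}R/R, (S^{-1}R/R)^{(I)}) = 0 for every set I. -/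
open CategoryTheory

universe w u

/-- Precomposing a localization map with an injection with `S`-torsion cokernel is again a
localization map. -/
theorem IsLocalizedModule.comp_of_injective_of_exists_smul_mem_range {R N P P' : Type*}
    [CommSemiring R] [AddCommMonoid N] [AddCommMonoid P] [AddCommMonoid P'] [Module R N]
    [Module R P] [Module R P'] (S : Submonoid R) (f : N →ₗ[R] P) (g : P →ₗ[R] P')
    [IsLocalizedModule S g] (hf : Function.Injective f)
    (htors : ∀ p, ∃ s : S, s • p ∈ LinearMap.range f) :
    IsLocalizedModule S (g ∘ₗ f) where
  map_units := IsLocalizedModule.map_units g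
  surj y := by
    obtain ⟨⟨p, s⟩, hp⟩ := IsLocalizedModule.surj S g y
    obtain ⟨t, n, hn⟩ := htors p
    refine ⟨⟨n, t * s⟩, ?_⟩
    simp [mul_smul, hp, hn]
  exists_of_eq {x y} h := by
    obtain ⟨c, hc⟩ := IsLocalizedModule.exists_of_eq (S := S) (f := g) h
    exact ⟨c, hf (by simpa using hc)⟩

/-- There are no nontrivial extensions of an `S`-torsion module by an `S`-local module. -/
theorem ModuleCat.subsingleton_ext_one_of_torsion_of_isUnit {R : Type u} [CommRing R]
    [HasExt.{w} (ModuleCat.{u} R)] (S : Submonoid R) (A M : ModuleCat.{u} R)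
    (hA : ∀ a : A, ∃ s : S, s • a = 0)
    (hM : ∀ s : S, IsUnit (algebraMap R (Module.End R M) s)) :
    Subsingleton (Abelian.Ext A M 1) := by
  have hT := A.shortExact_projectiveShortComplex
  let l := LocalizedModule.mkLinearMap S A.projectiveShortComplex.X₂
  have hloc : IsLocalizedModule S (l ∘ₗ A.projectiveShortComplex.f.hom) := by
    refine IsLocalizedModule.comp_of_injective_of_exists_smul_mem_range S _ _
      hT.moduleCat_injective_f fun p ↦ ?_
    obtain ⟨s, hs⟩ := hA (A.projectiveShortComplex.g p)
    refine ⟨s, hT.exact.moduleCat_range_eq_ker ▸ ?_⟩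
    exact LinearMap.mem_ker.mpr ((map_smul A.projectiveShortComplex.g.hom (s : R) p).trans hs)
  refine subsingleton_of_forall_eq 0 fun x ↦ ?_
  have : Projective A.projectiveShortComplex.X₂ :=
    ModuleCat.projective_of_free (Module.Free.chooseBasis R A.projectiveShortComplex.X₂)
  obtain ⟨y, rfl⟩ := Abelian.Ext.contravariant_sequence_exact₃ hT M x
    (Abelian.Ext.eq_zero_of_projective _) (n₀ := 0) rfl
  obtain ⟨φ, rfl⟩ := Abelian.Ext.addEquiv₀.symm.surjective y
  have hφ : A.projectiveShortComplex.f ≫ ModuleCat.ofHom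
      (IsLocalizedModule.lift S (l ∘ₗ A.projectiveShortComplex.f.hom) φ.hom hM ∘ₗ l) = φ := by
    ext1
    exact IsLocalizedModule.lift_comp S (l ∘ₗ A.projectiveShortComplex.f.hom) φ.hom hM
  rw [Abelian.Ext.addEquiv₀_symm_apply]
  rw [← hφ, ← Abelian.Ext.mk₀_comp_mk₀]
  exact hT.extClass_comp_assoc _

/-- let `R` be a commutative ring and `S ⊆ R` a multiplicative subset
of nonzero-divisors such that the `R`-module `S⁻¹R` has projective dimension at
most `1`.  Then `Ext¹_R(S⁻¹R/R, (S⁻¹R/R)^{(I)}) = 0` for every set `I`. -/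
theorem statement9 (R : Type u) [CommRing R] (S : Submonoid R)
    [HasExt.{w} (ModuleCat.{u} R)]
    (hS : ∀ s ∈ S, s ∈ nonZeroDivisors R)
    (hpd : ∀ (i : ℕ), 1 < i → ∀ X : ModuleCat.{u} R,
      Subsingleton (Abelian.Ext (ModuleCat.of R (Localization S)) X i))
    (I : Type u) :
    Subsingleton (Abelian.Ext
      (ModuleCat.of R
        (Localization S ⧸ LinearMap.range (Algebra.linearMap R (Localization S))))
      (ModuleCat.of R
        (I →₀ (Localization S ⧸
          LinearMap.range (Algebra.linearMap R (Localization S))))) 1) := by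
  let ι := Algebra.linearMap R (Localization S)
  let π := (LinearMap.range ι).mkQ
  have hι : Function.Injective ι := IsLocalization.injective _ hS
  have hιπ : Function.Exact ι π := LinearMap.exact_map_mkQ_range ι
  have hπ : Function.Surjective π := Submodule.mkQ_surjective _
  let T := ModuleCat.shortComplexOfCompEqZero ι π hιπ.linearMap_comp_eq_zero
  have hT : T.ShortExact := ModuleCat.shortComplex_shortExact T hιπ hι hπ
  let ιI := Finsupp.mapRange.linearMap (α := I) ι
  let πI := Finsupp.mapRange.linearMap (α := I) π
  have hιπI : Function.Exact ιI πI := by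
    refine LinearMap.exact_iff.mpr ?_
    rw [Finsupp.ker_mapRange, Finsupp.range_mapRange_linearMap _ (LinearMap.ker_eq_bot.mpr hι),
      hιπ.linearMap_ker_eq]
  let TI := ModuleCat.shortComplexOfCompEqZero ιI πI hιπI.linearMap_comp_eq_zero
  have hTI : TI.ShortExact := ModuleCat.shortComplex_shortExact TI hιπI
    (Finsupp.mapRange_injective _ (map_zero _) hι) (Finsupp.mapRange_surjective _ (map_zero _) hπ)
  have h₁ : Subsingleton (Abelian.Ext T.X₃ TI.X₂ 1) := by
    refine ModuleCat.subsingleton_ext_one_of_torsion_of_isUnit S _ _ (fun a ↦ ?_)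
      (IsLocalizedModule.map_units ιI)
    obtain ⟨q, rfl⟩ := hπ a
    obtain ⟨⟨r, s⟩, hr⟩ := IsLocalizedModule.surj S ι q
    exact ⟨s, by rw [Submonoid.smul_def, ← map_smul, ← Submonoid.smul_def, hr,
      hιπ.apply_apply_eq_zero]⟩
  have h₂ : Subsingleton (Abelian.Ext T.X₃ TI.X₁ 2) := by
    refine subsingleton_of_forall_eq 0 fun x ↦ ?_
    have := hpd 2 one_lt_two TI.X₁
    have : Projective T.X₁ := ModuleCat.projective_of_free (Module.Basis.singleton Unit R)
    obtain ⟨y, rfl⟩ := Abelian.Ext.contravariant_sequence_exact₃ hT _ x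
      (Subsingleton.elim (α := Abelian.Ext (ModuleCat.of R (Localization S)) TI.X₁ 2) _ _)
      (n₀ := 1) rfl
    simp [Abelian.Ext.eq_zero_of_projective y]
  refine subsingleton_of_forall_eq 0 fun x ↦ ?_
  obtain ⟨y, rfl⟩ := Abelian.Ext.covariant_sequence_exact₃ T.X₃ hTI x rfl (Subsingleton.elim _ _)
  rw [Subsingleton.elim y 0, Abelian.Ext.zero_comp]
end

section
/- Let R be a commutative ring and S ⊂ R a multiplicative set of nonzero-divisors with pd_R(S^{-1}R) ≤ 1. If X• is a complex of S-torsion R-modules such that RHom_R(S^{-1}R/R, X•) = 0 in the derived category, then X• is acyclic. -/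
open CategoryTheory Limits

universe w w' u

section

variable {C : Type*} [Category* C] [Abelian C] [HasDerivedCategory C]

/-- Given a short exact sequence `T`, if there are no nonzero morphisms from `T.X₃` to `Z` and
`Z⟦1⟧` in the derived category, then an endomorphism of `T.X₁` which extends to an automorphism
of `T.X₂` can be cancelled on the left of morphisms to `Z`. -/
lemma DerivedCategory.eq_zero_of_singleFunctor_map_comp_eq_zero
    {T : ShortComplex C} (hT : T.ShortExact) {Z : DerivedCategory C}
    (h₀ : ∀ φ : (singleFunctor C 0).obj T.X₃ ⟶ Z, φ = 0)
    (h₁ : ∀ φ : (singleFunctor C 0).obj T.X₃ ⟶ Z⟦(1 : ℤ)⟧, φ = 0)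
    (a₁ : T.X₁ ⟶ T.X₁) (a₂ : T.X₂ ⟶ T.X₂) [IsIso a₂] (comm : a₁ ≫ T.f = T.f ≫ a₂)
    (f : (singleFunctor C 0).obj T.X₁ ⟶ Z) (hf : (singleFunctor C 0).map a₁ ≫ f = 0) :
    f = 0 := by
  obtain ⟨g, hg⟩ : ∃ g : ((singleFunctor C 0).obj T.X₂)⟦(1 : ℤ)⟧ ⟶ Z⟦(1 : ℤ)⟧,
      f⟦1⟧' = (-((singleFunctor C 0).map T.f)⟦1⟧') ≫ g :=
    Pretriangulated.Triangle.yoneda_exact₃ _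
      (Pretriangulated.rot_of_distTriang _ hT.singleTriangle_distinguished) (f⟦1⟧') (h₁ _)
  obtain ⟨g, rfl⟩ := (shiftFunctor (DerivedCategory C) (1 : ℤ)).map_surjective g
  obtain rfl : f = (singleFunctor C 0).map T.f ≫ (-g) :=
    (shiftFunctor (DerivedCategory C) (1 : ℤ)).map_injective (by simpa using hg)
  have hg' : (singleFunctor C 0).map T.f ≫ (singleFunctor C 0).map a₂ ≫ (-g) = 0 := by
    rw [← Functor.map_comp_assoc, ← comm, Functor.map_comp_assoc, hf]
  obtain ⟨h, hh⟩ : ∃ h : (singleFunctor C 0).obj T.X₃ ⟶ Z,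
      (singleFunctor C 0).map a₂ ≫ (-g) = (singleFunctor C 0).map T.g ≫ h :=
    Pretriangulated.Triangle.yoneda_exact₂ _ hT.singleTriangle_distinguished _ hg'
  rw [h₀ h, comp_zero] at hh
  rw [(cancel_epi ((singleFunctor C 0).map a₂)).1 (hh.trans comp_zero.symm), comp_zero]

/-- A morphism `k` to the cycles of `K` vanishes in homology if the morphism of complexes
it induces vanishes in the derived category. -/
lemma DerivedCategory.comp_homologyπ_eq_zero {A : C} {K : CochainComplex C ℤ} {n : ℤ}
    (k : A ⟶ K.cycles n) {f : (HomologicalComplex.single C (.up ℤ) n).obj A ⟶ K}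
    (hf : f.f n = (HomologicalComplex.singleObjXSelf (.up ℤ) n A).hom ≫ k ≫ K.iCycles n)
    (hQ : Q.map f = 0) :
    k ≫ K.homologyπ n = 0 := by
  have hk : (HomologicalComplex.singleObjCyclesSelfIso (.up ℤ) n A).inv ≫
      HomologicalComplex.cyclesMap f n = k := by
    simp [← cancel_mono (K.iCycles n), hf]
  have hf₀ : HomologicalComplex.homologyMap f n = 0 := by
    refine (cancel_epi ((homologyFunctorFactors C n).hom.app _)).1 ?_
    refine (homologyFunctorFactors_hom_naturality f n).symm.trans ?_
    rw [hQ, Functor.map_zero, zero_comp]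
    exact comp_zero.symm
  rw [← hk, Category.assoc, ← HomologicalComplex.homologyπ_naturality, hf₀, comp_zero, comp_zero]

end

section

variable {R : Type u} [CommRing R]

/-- The short exact sequence `0 ⟶ R ⟶ S⁻¹R ⟶ S⁻¹R/R ⟶ 0` when `S` consists of nonzerodivisors. -/
lemma Localization.shortExact_of_le_nonZeroDivisors {S : Submonoid R} (hS : S ≤ nonZeroDivisors R) :
    (ShortComplex.mk (ModuleCat.ofHom (Algebra.linearMap R (Localization S)))
      (ModuleCat.ofHom (LinearMap.range (Algebra.linearMap R (Localization S))).mkQ)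
      (by ext : 1; exact LinearMap.range_mkQ_comp _)).ShortExact := by
  refine ModuleCat.shortComplex_shortExact _ ?_ ?_ ?_
  · exact LinearMap.exact_map_mkQ_range _
  · exact IsLocalization.injective _ hS
  · exact Submodule.mkQ_surjective _

/-- A complex `K` of `S`-torsion modules is exact in degree `0` if there are no nonzero morphisms
from `S⁻¹R/R` to `K` and `K⟦1⟧` in the derived category. -/
lemma CochainComplex.isZero_homology_zero_of_torsion [HasDerivedCategory.{w'} (ModuleCat.{u} R)]
    {S : Submonoid R} (hS : S ≤ nonZeroDivisors R) (K : CochainComplex (ModuleCat.{u} R) ℤ)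
    (htors : ∀ x : K.X 0, ∃ s ∈ S, s • x = 0)
    (h₀ : ∀ φ : (DerivedCategory.singleFunctor (ModuleCat.{u} R) 0).obj
      (ModuleCat.of R (Localization S ⧸ LinearMap.range (Algebra.linearMap R (Localization S)))) ⟶
        DerivedCategory.Q.obj K, φ = 0)
    (h₁ : ∀ φ : (DerivedCategory.singleFunctor (ModuleCat.{u} R) 0).obj
      (ModuleCat.of R (Localization S ⧸ LinearMap.range (Algebra.linearMap R (Localization S)))) ⟶
        (DerivedCategory.Q.obj K)⟦(1 : ℤ)⟧, φ = 0) :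
    IsZero (K.homology 0) := by
  suffices K.homologyπ 0 = 0 from IsZero.of_epi_eq_zero _ this
  ext y
  obtain ⟨s, hs, hsy⟩ := htors (K.iCycles 0 y)
  replace hsy : s • y = 0 :=
    (ModuleCat.mono_iff_injective (K.iCycles 0)).1 inferInstance
      ((map_smul (K.iCycles 0).hom s y).trans (hsy.trans (map_zero _).symm))
  let k : ModuleCat.of R R ⟶ K.cycles 0 := ModuleCat.ofHom (LinearMap.toSpanSingleton R _ y)
  let f : (HomologicalComplex.single _ (.up ℤ) 0).obj (ModuleCat.of R R) ⟶ K :=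
    HomologicalComplex.mkHomFromSingle (k ≫ K.iCycles 0) (by simp)
  let a (M : ModuleCat.{u} R) : M ⟶ M := ModuleCat.ofHom (LinearMap.lsmul R M s)
  have : IsIso (a (ModuleCat.of R (Localization S))) :=
    (ConcreteCategory.isIso_iff_bijective _).2 ((Module.End.isUnit_iff _).1
      (IsLocalizedModule.map_units (Algebra.linearMap R (Localization S)) ⟨s, hs⟩))
  have hak : a _ ≫ k = 0 := by
    ext : 2
    exact (LinearMap.toSpanSingleton_apply ..).trans ((congrArg (· • y) (mul_one s)).trans hsy)
  have haf : (HomologicalComplex.single _ (.up ℤ) 0).map (a _) ≫ f = 0 := by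
    apply HomologicalComplex.from_single_hom_ext
    simp [f, HomologicalComplex.single_map_f_self, reassoc_of% hak]
  have hf : DerivedCategory.Q.map f = 0 :=
    DerivedCategory.eq_zero_of_singleFunctor_map_comp_eq_zero
      (Localization.shortExact_of_le_nonZeroDivisors hS) h₀ h₁ (a _) (a _)
      (by ext : 1; exact LinearMap.ext (map_smul (Algebra.linearMap R _) s)) _ <| by
        change DerivedCategory.Q.map ((HomologicalComplex.single _ (.up ℤ) 0).map (a _)) ≫ _ = 0
        rw [← Functor.map_comp, haf, Functor.map_zero]
  have := DerivedCategory.comp_homologyπ_eq_zero k (f := f) (by simp [f]) hf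
  have := ConcreteCategory.congr_hom this (1 : R)
  rwa [ConcreteCategory.comp_apply, show k (1 : R) = y from one_smul R y] at this

end

/-- let `R` be a commutative ring and `S` a multiplicative set of
nonzero-divisors with `pd_R(S⁻¹R) ≤ 1`.  If `X•` is a complex of `S`-torsion
`R`-modules such that `RHom_R(S⁻¹R/R, X•) = 0` in the derived category, then
`X•` is acyclic. -/
theorem statement10 (R : Type u) [CommRing R] (S : Submonoid R)
    [HasExt.{w} (ModuleCat.{u} R)] [HasDerivedCategory.{w'} (ModuleCat.{u} R)]
    (hS : ∀ s ∈ S, s ∈ nonZeroDivisors R)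
    (hpd : ∀ (i : ℕ), 1 < i → ∀ Y : ModuleCat.{u} R,
      Subsingleton (Abelian.Ext (ModuleCat.of R (Localization S)) Y i))
    (X : CochainComplex (ModuleCat.{u} R) ℤ)
    -- every term of `X•` is an `S`-torsion module
    (htors : ∀ (i : ℤ) (x : (X.X i)), ∃ s ∈ S, s • x = 0)
    -- `RHom_R(S⁻¹R/R, X•) = 0`
    (hRHom : ∀ (i : ℤ)
      (φ : (DerivedCategory.singleFunctor (ModuleCat.{u} R) 0).obj
          (ModuleCat.of R
            (Localization S ⧸
              LinearMap.range (Algebra.linearMap R (Localization S)))) ⟶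
        (DerivedCategory.Q.obj X)⟦i⟧), φ = 0) :
    ∀ i : ℤ, IsZero (X.homology i) := by
  intro i
  let e := (DerivedCategory.Q.commShiftIso (C := CochainComplex (ModuleCat.{u} R) ℤ) i).app X
  have h := CochainComplex.isZero_homology_zero_of_torsion hS (X⟦i⟧) (htors _)
    (fun φ ↦ by
      rw [← cancel_mono e.hom, zero_comp]
      exact hRHom i _)
    (fun φ ↦ by
      rw [← cancel_mono (e.hom⟦(1 : ℤ)⟧'), ← cancel_mono
        ((shiftFunctorAdd (DerivedCategory (ModuleCat.{u} R)) i 1).inv.app _), zero_comp, zero_comp]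
      exact hRHom (i + 1) _)
  exact h.of_iso ((CochainComplex.ShiftSequence.shiftIso _ i 0 i (add_zero i)).app X).symm
end
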